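/- arXiv:2503.15486 — 2 statements merged into one kernel-verified Lean document; each statement's English description precedes it below -/
import Mathlib

section
/- If a trajectory, policies, and multipliers (λ^i, ψ^i) satisfy both agents' feedback KKT systems, then the same trajectory with the same multipliers λ^i satisfies both agents' open-loop KKT systems. (First-order part of Theorem 1: the controls and states of any local FBNE satisfy the first-order necessary conditions for a local OLNE.) -/
open Matrix

noncomputable def grad {p : ℕ} (G : (Fin p → ℝ) → ℝ) (a : Fin p → ℝ) : Fin p → ℝ :=
  fun j => fderiv ℝ G a (Pi.single j 1)

noncomputable def jacT {p q : ℕ} (F : (Fin p → ℝ) → Fin q → ℝ) (a : Fin p → ℝ)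
    (lam : Fin q → ℝ) : Fin p → ℝ :=
  fun j => lam ⬝ᵥ fderiv ℝ F a (Pi.single j 1)

theorem grad_fun_neg {p : ℕ} (G : (Fin p → ℝ) → ℝ) (a : Fin p → ℝ) :
    grad (fun y => -(G y)) a = -grad G a := by
  funext j
  simp [grad, fderiv_fun_neg]

theorem jacT_neg {p q : ℕ} (F : (Fin p → ℝ) → Fin q → ℝ) (a : Fin p → ℝ) (lam : Fin q → ℝ) :
    jacT F a (-lam) = -jacT F a lam := by
  funext j
  simp [jacT]

theorem jacT_zero {p q : ℕ} (F : (Fin p → ℝ) → Fin q → ℝ) (a : Fin p → ℝ) :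
    jacT F a 0 = 0 := by
  funext j
  simp [jacT]

/-- A trajectory satisfying both agents' feedback KKT systems also satisfies,
with the same multipliers `λⁱ`, both agents' open-loop KKT systems (first-order part of
Theorem 1). -/
theorem fbne_implies_olne_first_order
    {n m1 m2 K : ℕ} (hK : 1 ≤ K)
    (f : ℕ → (Fin n → ℝ) → (Fin m1 → ℝ) → (Fin m2 → ℝ) → Fin n → ℝ)
    (l : ℕ → (Fin n → ℝ) → (Fin m1 → ℝ) → (Fin m2 → ℝ) → ℝ)
    (lf : (Fin n → ℝ) → ℝ)
    (x : ℕ → Fin n → ℝ) (u1 : ℕ → Fin m1 → ℝ) (u2 : ℕ → Fin m2 → ℝ)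
    (pi1 : ℕ → (Fin n → ℝ) → Fin m1 → ℝ) (pi2 : ℕ → (Fin n → ℝ) → Fin m2 → ℝ)
    (lam1 lam2 : ℕ → Fin n → ℝ)
    (psi1 : ℕ → Fin m2 → ℝ) (psi2 : ℕ → Fin m1 → ℝ)
    (hfd : ∀ t, 1 ≤ t → t ≤ K → Differentiable ℝ
      (fun p : (Fin n → ℝ) × (Fin m1 → ℝ) × (Fin m2 → ℝ) => f t p.1 p.2.1 p.2.2))
    (hld : ∀ t, 1 ≤ t → t ≤ K → Differentiable ℝ
      (fun p : (Fin n → ℝ) × (Fin m1 → ℝ) × (Fin m2 → ℝ) => l t p.1 p.2.1 p.2.2))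
    (hlfd : Differentiable ℝ lf)
    (hpi1d : ∀ s, 2 ≤ s → s ≤ K → Differentiable ℝ (pi1 s))
    (hpi2d : ∀ s, 2 ≤ s → s ≤ K → Differentiable ℝ (pi2 s))
    (hdyn : ∀ t, 1 ≤ t → t ≤ K → x (t+1) = f t (x t) (u1 t) (u2 t))
    (hpc1 : ∀ s, 2 ≤ s → s ≤ K → pi1 s (x s) = u1 s)
    (hpc2 : ∀ s, 2 ≤ s → s ≤ K → pi2 s (x s) = u2 s)
    (hFB1a : ∀ s, 2 ≤ s → s ≤ K → grad (fun w => l s (x s) (u1 s) w) (u2 s)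
      + jacT (fun w => f s (x s) (u1 s) w) (u2 s) (lam1 s) - psi1 s = 0)
    (hFB1b : ∀ s, 2 ≤ s → s ≤ K → grad (fun w => -(l s (x s) w (u2 s))) (u1 s)
      + jacT (fun w => f s (x s) w (u2 s)) (u1 s) (lam2 s) - psi2 s = 0)
    (hFB2a : ∀ t, 1 ≤ t → t ≤ K → grad (fun w => l t (x t) w (u2 t)) (u1 t)
      + jacT (fun w => f t (x t) w (u2 t)) (u1 t) (lam1 t) = 0)
    (hFB2b : ∀ t, 1 ≤ t → t ≤ K → grad (fun w => -(l t (x t) (u1 t) w)) (u2 t)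
      + jacT (fun w => f t (x t) (u1 t) w) (u2 t) (lam2 t) = 0)
    (hFB3a : grad lf (x (K+1)) - lam1 K = 0)
    (hFB3b : grad (fun y => -(lf y)) (x (K+1)) - lam2 K = 0)
    (hFB4a : ∀ s, 2 ≤ s → s ≤ K → grad (fun y => l s y (u1 s) (u2 s)) (x s) - lam1 (s-1)
      + jacT (fun y => f s y (u1 s) (u2 s)) (x s) (lam1 s) + jacT (pi2 s) (x s) (psi1 s) = 0)
    (hFB4b : ∀ s, 2 ≤ s → s ≤ K → grad (fun y => -(l s y (u1 s) (u2 s))) (x s) - lam2 (s-1)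
      + jacT (fun y => f s y (u1 s) (u2 s)) (x s) (lam2 s) + jacT (pi1 s) (x s) (psi2 s) = 0)
 :
    (∀ t, 2 ≤ t → t ≤ K → grad (fun y => l t y (u1 t) (u2 t)) (x t)
      + jacT (fun y => f t y (u1 t) (u2 t)) (x t) (lam1 t) - lam1 (t-1) = 0) ∧
    (∀ t, 2 ≤ t → t ≤ K → grad (fun y => -(l t y (u1 t) (u2 t))) (x t)
      + jacT (fun y => f t y (u1 t) (u2 t)) (x t) (lam2 t) - lam2 (t-1) = 0) ∧
    (∀ t, 1 ≤ t → t ≤ K → grad (fun w => l t (x t) w (u2 t)) (u1 t)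
      + jacT (fun w => f t (x t) w (u2 t)) (u1 t) (lam1 t) = 0) ∧
    (∀ t, 1 ≤ t → t ≤ K → grad (fun w => -(l t (x t) (u1 t) w)) (u2 t)
      + jacT (fun w => f t (x t) (u1 t) w) (u2 t) (lam2 t) = 0) ∧
    (grad lf (x (K+1)) - lam1 K = 0) ∧
    (grad (fun y => -(lf y)) (x (K+1)) - lam2 K = 0) := by
  simp only [grad_fun_neg] at *
  have psi_eq_zero : ∀ s, 2 ≤ s → s ≤ K → lam2 s = -lam1 s → psi1 s = 0 ∧ psi2 s = 0 := by
    intro s hs hsK h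
    have h1 := hFB1a s hs hsK
    have h2 := hFB1b s hs hsK
    have h3 := hFB2a s (by omega) hsK
    have h4 := hFB2b s (by omega) hsK
    rw [h, jacT_neg] at h2 h4
    constructor
    · linear_combination -h1 - h4
    · linear_combination -h2 - h3
  have costate_neg : ∀ t, 1 ≤ t → t ≤ K → lam2 t = -lam1 t := by
    intro t ht htK
    induction htK using Nat.decreasingInduction with
    | self => linear_combination -hFB3a - hFB3b
    | of_succ s hsK ih =>
      have h := ih (by omega)
      obtain ⟨hp1, hp2⟩ := psi_eq_zero (s + 1) (by omega) hsK h
      have h1 := hFB4a (s + 1) (by omega) hsK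
      have h2 := hFB4b (s + 1) (by omega) hsK
      rw [hp1, jacT_zero, Nat.add_sub_cancel] at h1
      rw [hp2, jacT_zero, h, jacT_neg, Nat.add_sub_cancel] at h2
      linear_combination -h1 - h2
  refine ⟨fun t ht htK => ?_, fun t ht htK => ?_, hFB2a, hFB2b, hFB3a, hFB3b⟩
  · have h := hFB4a t ht htK
    rw [(psi_eq_zero t ht htK (costate_neg t (by omega) htK)).1, jacT_zero] at h
    linear_combination h
  · have h := hFB4b t ht htK
    rw [(psi_eq_zero t ht htK (costate_neg t (by omega) htK)).2, jacT_zero] at h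
    linear_combination h
end

section
/- At a local feedback Nash equilibrium (value-function formulation) with each Z_t differentiable, define λ¹_t = ∇V_{t+1}(x_{t+1}) and λ²_t = −λ¹_t for t = 1,…,K. Then the closed-loop trajectory together with these multipliers satisfies both agents' open-loop KKT systems: for each i ∈ {1,2}, (OL1) ∇_x g^i_t + (D_x f_t)^⊤ λ^i_t − λ^i_{t−1} = 0 for t = 2,…,K; (OL2) ∇_{u^i} g^i_t + (D_{u^i} f_t)^⊤ λ^i_t = 0 for t = 1,…,K; (OL3) ∇g^i_{K+1}(x_{K+1}) − λ^i_K = 0, where g¹_t = ℓ_t and g²_t = −ℓ_t. -/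
open Matrix

theorem grad_dotProduct {p : ℕ} (G : (Fin p → ℝ) → ℝ) (a v : Fin p → ℝ) :
    grad G a ⬝ᵥ v = fderiv ℝ G a v := by
  conv_rhs => rw [← Finset.univ_sum_single v, map_sum]
  refine Finset.sum_congr rfl fun j _ => ?_
  have h : (Pi.single j (v j) : Fin p → ℝ) = v j • Pi.single j 1 := by
    rw [← Pi.single_smul, smul_eq_mul, mul_one]
  rw [h, map_smul, smul_eq_mul, mul_comm]
  rfl

theorem grad_neg {p : ℕ} (G : (Fin p → ℝ) → ℝ) (a : Fin p → ℝ) :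
    grad (fun y => -G y) a = -grad G a := by
  funext j
  simp [grad, fderiv_fun_neg]

theorem grad_eq_zero_of_isLocalExtr {p : ℕ} {G : (Fin p → ℝ) → ℝ} {a : Fin p → ℝ}
    (h : IsLocalExtr G a) : grad G a = 0 := by
  funext j
  simp [grad, h.fderiv_eq_zero]

theorem grad_add_comp {p q : ℕ} {G : (Fin p → ℝ) → ℝ} {F : (Fin p → ℝ) → Fin q → ℝ}
    {W : (Fin q → ℝ) → ℝ} {a : Fin p → ℝ} (hG : DifferentiableAt ℝ G a)
    (hF : DifferentiableAt ℝ F a) (hW : DifferentiableAt ℝ W (F a)) :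
    grad (fun y => G y + W (F y)) a = grad G a + jacT F a (grad W (F a)) := by
  funext j
  have h := (hG.hasFDerivAt.add (hW.hasFDerivAt.comp a hF.hasFDerivAt)).fderiv
  have hsum : fderiv ℝ (fun y => G y + W (F y)) a = _ := h
  simp [grad, jacT, hsum, grad_dotProduct]

/-- Envelope theorem: along stationary controls, the policies do not contribute to the
derivative of the value function. -/
theorem fderiv_comp_policies_eq {X U₁ U₂ : Type*}
    [NormedAddCommGroup X] [NormedSpace ℝ X] [NormedAddCommGroup U₁] [NormedSpace ℝ U₁]
    [NormedAddCommGroup U₂] [NormedSpace ℝ U₂]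
    {Z : X × U₁ × U₂ → ℝ} {p : X → U₁} {q : X → U₂} {a : X}
    (hZ : DifferentiableAt ℝ Z (a, p a, q a))
    (hp : DifferentiableAt ℝ p a) (hq : DifferentiableAt ℝ q a)
    (h₁ : fderiv ℝ (fun w => Z (a, w, q a)) (p a) = 0)
    (h₂ : fderiv ℝ (fun w => Z (a, p a, w)) (q a) = 0) :
    fderiv ℝ (fun y => Z (y, p y, q y)) a = fderiv ℝ (fun y => Z (y, p a, q a)) a := by
  set D := fderiv ℝ Z (a, p a, q a)
  have hZD : HasFDerivAt Z D (a, p a, q a) := hZ.hasFDerivAt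
  have e₁ := (hZD.comp (p a) ((hasFDerivAt_const a (p a)).prodMk
    ((hasFDerivAt_id (p a)).prodMk (hasFDerivAt_const (q a) (p a))))).fderiv.symm.trans h₁
  have e₂ := (hZD.comp (q a) ((hasFDerivAt_const a (q a)).prodMk
    ((hasFDerivAt_const (p a) (q a)).prodMk (hasFDerivAt_id (q a))))).fderiv.symm.trans h₂
  have e := (HasFDerivAt.comp (f := fun y => (y, p y, q y)) a hZD
    ((hasFDerivAt_id a).prodMk (hp.hasFDerivAt.prodMk hq.hasFDerivAt))).fderiv
  have e₀ := (HasFDerivAt.comp (f := fun y => (y, p a, q a)) a hZD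
    ((hasFDerivAt_id a).prodMk
      ((hasFDerivAt_const (p a) a).prodMk (hasFDerivAt_const (q a) a)))).fderiv
  refine e.trans (Eq.trans ?_ e₀.symm)
  ext v
  have z₁ : D (0, fderiv ℝ p a v, 0) = 0 := DFunLike.congr_fun e₁ (fderiv ℝ p a v)
  have z₂ : D (0, 0, fderiv ℝ q a v) = 0 := DFunLike.congr_fun e₂ (fderiv ℝ q a v)
  have hv : ((v, fderiv ℝ p a v, fderiv ℝ q a v) : X × U₁ × U₂) =
      (v, 0, 0) + (0, fderiv ℝ p a v, 0) + (0, 0, fderiv ℝ q a v) := by simp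
  change D (v, fderiv ℝ p a v, fderiv ℝ q a v) = D (v, 0, 0)
  rw [hv, map_add, map_add, z₁, z₂, add_zero, add_zero]

/-- At a local FBNE (value-function formulation), the multipliers
`λ¹_t := ∇V_{t+1}(x_{t+1})`, `λ²_t := -λ¹_t` satisfy both agents' open-loop KKT
systems along the closed-loop trajectory. -/
theorem fbne_value_function_gives_ol_kkt
    {n m1 m2 K : ℕ} (hK : 1 ≤ K)
    (f : ℕ → (Fin n → ℝ) → (Fin m1 → ℝ) → (Fin m2 → ℝ) → Fin n → ℝ)
    (l : ℕ → (Fin n → ℝ) → (Fin m1 → ℝ) → (Fin m2 → ℝ) → ℝ)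
    (lf : (Fin n → ℝ) → ℝ)
    (x : ℕ → Fin n → ℝ) (u1 : ℕ → Fin m1 → ℝ) (u2 : ℕ → Fin m2 → ℝ)
    (pi1 : ℕ → (Fin n → ℝ) → Fin m1 → ℝ) (pi2 : ℕ → (Fin n → ℝ) → Fin m2 → ℝ)
    (hfd : ∀ t, 1 ≤ t → t ≤ K → Differentiable ℝ
      (fun p : (Fin n → ℝ) × (Fin m1 → ℝ) × (Fin m2 → ℝ) => f t p.1 p.2.1 p.2.2))
    (hld : ∀ t, 1 ≤ t → t ≤ K → Differentiable ℝ
      (fun p : (Fin n → ℝ) × (Fin m1 → ℝ) × (Fin m2 → ℝ) => l t p.1 p.2.1 p.2.2))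
    (hlfd : Differentiable ℝ lf)
    (hpi1d : ∀ t, 1 ≤ t → t ≤ K → Differentiable ℝ (pi1 t))
    (hpi2d : ∀ t, 1 ≤ t → t ≤ K → Differentiable ℝ (pi2 t))
    (V : ℕ → (Fin n → ℝ) → ℝ)
    (hVterm : ∀ y, V (K+1) y = lf y)
    (hVrec : ∀ t, 1 ≤ t → t ≤ K → ∀ y,
      V t y = l t y (pi1 t y) (pi2 t y) + V (t+1) (f t y (pi1 t y) (pi2 t y)))
    (hVd : ∀ t, 1 ≤ t → t ≤ K+1 → Differentiable ℝ (V t))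
    (hZd : ∀ t, 1 ≤ t → t ≤ K → Differentiable ℝ
      (fun p : (Fin n → ℝ) × (Fin m1 → ℝ) × (Fin m2 → ℝ) =>
        l t p.1 p.2.1 p.2.2 + V (t+1) (f t p.1 p.2.1 p.2.2)))
    (hu1 : ∀ t, 1 ≤ t → t ≤ K → u1 t = pi1 t (x t))
    (hu2 : ∀ t, 1 ≤ t → t ≤ K → u2 t = pi2 t (x t))
    (hdyn : ∀ t, 1 ≤ t → t ≤ K → x (t+1) = f t (x t) (u1 t) (u2 t))
    (hmin : ∀ t, 1 ≤ t → t ≤ K →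
      IsLocalMin (fun a => l t (x t) a (u2 t) + V (t+1) (f t (x t) a (u2 t))) (u1 t))
    (hmax : ∀ t, 1 ≤ t → t ≤ K →
      IsLocalMax (fun b => l t (x t) (u1 t) b + V (t+1) (f t (x t) (u1 t) b)) (u2 t))
 :
    ∀ lam1 lam2 : ℕ → Fin n → ℝ,
      (∀ t, 1 ≤ t → t ≤ K → lam1 t = grad (V (t+1)) (x (t+1))) →
      (∀ t, 1 ≤ t → t ≤ K → lam2 t = -lam1 t) →
      ((∀ t, 2 ≤ t → t ≤ K → grad (fun y => l t y (u1 t) (u2 t)) (x t)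
      + jacT (fun y => f t y (u1 t) (u2 t)) (x t) (lam1 t) - lam1 (t-1) = 0) ∧
       (∀ t, 1 ≤ t → t ≤ K → grad (fun w => l t (x t) w (u2 t)) (u1 t)
      + jacT (fun w => f t (x t) w (u2 t)) (u1 t) (lam1 t) = 0) ∧
       (grad lf (x (K+1)) - lam1 K = 0) ∧
       (∀ t, 2 ≤ t → t ≤ K → grad (fun y => -(l t y (u1 t) (u2 t))) (x t)
      + jacT (fun y => f t y (u1 t) (u2 t)) (x t) (lam2 t) - lam2 (t-1) = 0) ∧
       (∀ t, 1 ≤ t → t ≤ K → grad (fun w => -(l t (x t) (u1 t) w)) (u2 t)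
      + jacT (fun w => f t (x t) (u1 t) w) (u2 t) (lam2 t) = 0) ∧
       (grad (fun y => -(lf y)) (x (K+1)) - lam2 K = 0)) := by
  intro lam1 lam2 hlam1 hlam2
  have hVt : ∀ t, 1 ≤ t → t ≤ K →
      DifferentiableAt ℝ (V (t+1)) (f t (x t) (u1 t) (u2 t)) := fun t h1 h2 =>
    hVd (t+1) (by lia) (by lia) _
  have hlam : ∀ t, 1 ≤ t → t ≤ K →
      grad (V (t+1)) (f t (x t) (u1 t) (u2 t)) = lam1 t := fun t h1 h2 => by
    rw [hlam1 t h1 h2, ← hdyn t h1 h2]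
  have costate : ∀ t, 2 ≤ t → t ≤ K → grad (fun y => l t y (u1 t) (u2 t)) (x t)
      + jacT (fun y => f t y (u1 t) (u2 t)) (x t) (lam1 t) = lam1 (t-1) := by
    intro t h2 hk
    have h1 : 1 ≤ t := by lia
    have hf := (hfd t h1 hk).comp (g := fun p : (Fin n → ℝ) × (Fin m1 → ℝ) × (Fin m2 → ℝ) =>
      f t p.1 p.2.1 p.2.2) (f := fun y => (y, u1 t, u2 t)) (by fun_prop)
    have hl := (hld t h1 hk).comp (g := fun p : (Fin n → ℝ) × (Fin m1 → ℝ) × (Fin m2 → ℝ) =>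
      l t p.1 p.2.1 p.2.2) (f := fun y => (y, u1 t, u2 t)) (by fun_prop)
    have hV : V t = fun y =>
        l t y (pi1 t y) (pi2 t y) + V (t+1) (f t y (pi1 t y) (pi2 t y)) :=
      funext (hVrec t h1 hk)
    have envelope := fderiv_comp_policies_eq (hZd t h1 hk (x t, pi1 t (x t), pi2 t (x t)))
      (hpi1d t h1 hk (x t)) (hpi2d t h1 hk (x t))
      (by have h := (hmin t h1 hk).fderiv_eq_zero
          rwa [hu1 t h1 hk, hu2 t h1 hk] at h)
      (by have h := (hmax t h1 hk).fderiv_eq_zero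
          rwa [hu1 t h1 hk, hu2 t h1 hk] at h)
    have chain := grad_add_comp (hl (x t)) (hf (x t)) (hVt t h1 hk)
    have hprev : lam1 (t-1) = grad (V t) (x t) := by
      rw [hlam1 (t-1) (by lia) (by lia), Nat.sub_add_cancel h1]
    rw [← hlam t h1 hk, hprev, hV]
    refine chain.symm.trans ?_
    funext j
    rw [← hu1 t h1 hk, ← hu2 t h1 hk] at envelope
    exact (DFunLike.congr_fun envelope (Pi.single j 1)).symm
  have stationary1 : ∀ t, 1 ≤ t → t ≤ K → grad (fun w => l t (x t) w (u2 t)) (u1 t)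
      + jacT (fun w => f t (x t) w (u2 t)) (u1 t) (lam1 t) = 0 := by
    intro t h1 hk
    have hf := (hfd t h1 hk).comp (g := fun p : (Fin n → ℝ) × (Fin m1 → ℝ) × (Fin m2 → ℝ) =>
      f t p.1 p.2.1 p.2.2) (f := fun w => (x t, w, u2 t)) (by fun_prop)
    have hl := (hld t h1 hk).comp (g := fun p : (Fin n → ℝ) × (Fin m1 → ℝ) × (Fin m2 → ℝ) =>
      l t p.1 p.2.1 p.2.2) (f := fun w => (x t, w, u2 t)) (by fun_prop)
    rw [← hlam t h1 hk]
    exact (grad_add_comp (hl (u1 t)) (hf (u1 t)) (hVt t h1 hk)).symm.trans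
      (grad_eq_zero_of_isLocalExtr (Or.inl (hmin t h1 hk)))
  have stationary2 : ∀ t, 1 ≤ t → t ≤ K → grad (fun w => l t (x t) (u1 t) w) (u2 t)
      + jacT (fun w => f t (x t) (u1 t) w) (u2 t) (lam1 t) = 0 := by
    intro t h1 hk
    have hf := (hfd t h1 hk).comp (g := fun p : (Fin n → ℝ) × (Fin m1 → ℝ) × (Fin m2 → ℝ) =>
      f t p.1 p.2.1 p.2.2) (f := fun w => (x t, u1 t, w)) (by fun_prop)
    have hl := (hld t h1 hk).comp (g := fun p : (Fin n → ℝ) × (Fin m1 → ℝ) × (Fin m2 → ℝ) =>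
      l t p.1 p.2.1 p.2.2) (f := fun w => (x t, u1 t, w)) (by fun_prop)
    rw [← hlam t h1 hk]
    exact (grad_add_comp (hl (u2 t)) (hf (u2 t)) (hVt t h1 hk)).symm.trans
      (grad_eq_zero_of_isLocalExtr (Or.inr (hmax t h1 hk)))
  have terminal : grad lf (x (K+1)) = lam1 K := by
    rw [hlam1 K hK le_rfl, funext hVterm]
  refine ⟨fun t h2 hk => sub_eq_zero.2 (costate t h2 hk), stationary1,
    sub_eq_zero.2 terminal, fun t h2 hk => ?_, fun t h1 hk => ?_, ?_⟩
  · rw [hlam2 t (by lia) hk, hlam2 (t-1) (by lia) (by lia), grad_neg, jacT_neg,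
      ← costate t h2 hk]
    abel
  · rw [hlam2 t h1 hk, grad_neg, jacT_neg, ← neg_add, stationary2 t h1 hk, neg_zero]
  · rw [hlam2 K hK le_rfl, grad_neg, terminal, sub_self]
end
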